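/- arXiv:math-ph/0603060 — 3 statements merged into one kernel-verified Lean document; each statement's English description precedes it below -/
import Mathlib

section
/- Conservation of the number of particles for the generalized nonlinear Schrödinger equation with potential: Let d ≥ 1, let V : ℝ^d → ℝ be continuous, and let f : ℝ → ℝ be continuous. Suppose ψ : ℝ → 𝓢(ℝ^d; ℂ) is continuously differentiable as a map into the Schwartz space and satisfies, for every t ∈ ℝ and x ∈ ℝ^d, the equation i ∂ₜψ(t)(x) = −Δψ(t)(x) + V(x) ψ(t)(x) − f(|ψ(t)(x)|²) ψ(t)(x). Then the function t ↦ ∫_{ℝ^d} |ψ(t)(x)|² dx is constant; i.e. N(ψ(t)) = N(ψ(0)) for all t, where N(ψ) := ∫ |ψ|². -/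
open MeasureTheory Filter

/-- The Laplacian: sum of second partial derivatives in the coordinate directions. -/
noncomputable def lap {d : ℕ} {F : Type} [NormedAddCommGroup F] [NormedSpace ℝ F]
    (g : EuclideanSpace ℝ (Fin d) → F) (x : EuclideanSpace ℝ (Fin d)) : F :=
  ∑ k : Fin d, fderiv ℝ (fun y => fderiv ℝ g y (EuclideanSpace.single k 1)) x
    (EuclideanSpace.single k 1)

open scoped Laplacian LineDeriv

/-- The coordinate Laplacian of a Schwartz function agrees with the Laplacian of Schwartz space. -/
lemma lap_schwartzMap {d : ℕ} (g : SchwartzMap (EuclideanSpace ℝ (Fin d)) ℂ)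
    (x : EuclideanSpace ℝ (Fin d)) : lap (fun y => g y) x = (Δ g) x := by
  rw [SchwartzMap.laplacian_eq_sum (EuclideanSpace.basisFun (Fin d) ℝ), sum_apply]
  simp only [lap, SchwartzMap.lineDerivOp_apply_eq_fderiv, EuclideanSpace.basisFun_apply]
  rfl

/-- The operator `IΔ` is antisymmetric for the real `L²` inner product. -/
lemma integral_inner_I_mul_laplacian {E : Type*} [NormedAddCommGroup E] [InnerProductSpace ℝ E]
    [FiniteDimensional ℝ E] [MeasureSpace E] [BorelSpace E]
    [(volume : Measure E).IsAddHaarMeasure] (g : SchwartzMap E ℂ) :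
    ∫ x, inner ℝ (g x) (Complex.I * (Δ g) x) = 0 := by
  have h := SchwartzMap.integral_bilinear_laplacian_right_eq_left (μ := volume) g g
    ((innerSL ℝ : ℂ →L[ℝ] ℂ →L[ℝ] ℝ).bilinearComp (.id ℝ ℂ)
      (ContinuousLinearMap.mul ℝ ℂ Complex.I))
  have hanti (a b : ℂ) : inner ℝ a (Complex.I * b) = -inner ℝ b (Complex.I * a) := by
    simp [Complex.inner]
    ring
  simp only [ContinuousLinearMap.bilinearComp_apply, ContinuousLinearMap.id_apply,
    innerSL_apply_apply, ContinuousLinearMap.mul_apply'] at h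
  simp_rw [fun x => hanti ((Δ g) x) (g x), integral_neg] at h
  linarith

/-- A curve in Schwartz space that is differentiable there is differentiable in `L²`. -/
lemma SchwartzMap.hasDerivAt_toLp {E : Type*} [NormedAddCommGroup E] [NormedSpace ℝ E] [MeasureSpace E]
    [BorelSpace E] [SecondCountableTopology E] [(volume : Measure E).HasTemperateGrowth]
    {ψ : ℝ → SchwartzMap E ℂ}
    {φ : SchwartzMap E ℂ} {t : ℝ}
    (h : Tendsto (fun h : ℝ => h⁻¹ • (ψ (t + h) - ψ t)) (nhdsWithin 0 {0}ᶜ) (nhds φ)) :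
    HasDerivAt (fun s => (ψ s).toLp 2 volume) (φ.toLp 2 volume) t := by
  rw [hasDerivAt_iff_tendsto_slope_zero]
  have := ((SchwartzMap.toLpCLM ℝ ℂ 2 (volume : Measure E)).continuous.tendsto φ).comp h
  simpa [Function.comp_def, map_smul, map_sub, -SchwartzMap.toLpCLM_apply,
    ← SchwartzMap.toLpCLM_apply (𝕜 := ℝ)] using this

lemma SchwartzMap.inner_toLp {E : Type*} [NormedAddCommGroup E] [NormedSpace ℝ E] [MeasureSpace E]
    [BorelSpace E] [SecondCountableTopology E] [(volume : Measure E).HasTemperateGrowth]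
    (g h : SchwartzMap E ℂ) :
    inner ℝ (g.toLp 2 volume) (h.toLp 2 volume) = ∫ x, inner ℝ (g x) (h x) := by
  rw [L2.inner_def]
  apply integral_congr_ae
  filter_upwards [g.coeFn_toLp 2 volume, h.coeFn_toLp 2 volume] with x hg hh
  rw [hg, hh]

/-- Conservation of the number of particles `N(ψ) = ∫ |ψ|²` for the generalized NLS
`i ∂ₜψ = -Δψ + Vψ - f(|ψ|²)ψ`, for solutions which are C¹ in time with values in
Schwartz space. -/
theorem particle_number_conservation (d : ℕ) (hd : 1 ≤ d)
    (V : EuclideanSpace ℝ (Fin d) → ℝ) (hV : Continuous V)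
    (f : ℝ → ℝ) (hf : Continuous f)
    (ψ dψ : ℝ → SchwartzMap (EuclideanSpace ℝ (Fin d)) ℂ)
    (hψc : Continuous ψ) (hdψc : Continuous dψ)
    (hderiv : ∀ t : ℝ, Tendsto (fun h : ℝ => h⁻¹ • (ψ (t + h) - ψ t))
      (nhdsWithin 0 {0}ᶜ) (nhds (dψ t)))
    (heq : ∀ (t : ℝ) (x : EuclideanSpace ℝ (Fin d)),
      Complex.I * dψ t x =
        -lap (fun y => ψ t y) x + (V x : ℂ) * ψ t x - (f (‖ψ t x‖ ^ 2) : ℂ) * ψ t x) :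
    ∀ t : ℝ, (∫ x, ‖ψ t x‖ ^ 2) = ∫ x, ‖ψ 0 x‖ ^ 2 := by
  have hnorm (t : ℝ) : ∫ x, ‖ψ t x‖ ^ 2 = ‖(ψ t).toLp 2 volume‖ ^ 2 := by
    rw [← real_inner_self_eq_norm_sq, SchwartzMap.inner_toLp]
    simp_rw [real_inner_self_eq_norm_sq]
  have hpoint (t : ℝ) (x : EuclideanSpace ℝ (Fin d)) :
      inner ℝ (ψ t x) (dψ t x) = inner ℝ (ψ t x) (Complex.I * (Δ (ψ t)) x) := by
    have hdψ : dψ t x = Complex.I * (Δ (ψ t)) x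
        - ((V x - f (‖ψ t x‖ ^ 2) : ℝ) : ℂ) * (Complex.I * ψ t x) := by
      have h := heq t x
      rw [lap_schwartzMap] at h
      push_cast
      linear_combination (-Complex.I) * h + dψ t x * Complex.I_mul_I
    rw [hdψ, inner_sub_right, ← Complex.real_smul, inner_smul_right]
    simp [Complex.inner]
    ring_nf
    simp
  have hN (t : ℝ) : HasDerivAt (fun s => ‖(ψ s).toLp 2 volume‖ ^ 2) 0 t := by
    convert (SchwartzMap.hasDerivAt_toLp (hderiv t)).norm_sq using 1
    rw [SchwartzMap.inner_toLp]
    simp_rw [hpoint, integral_inner_I_mul_laplacian, mul_zero]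
  intro t
  rw [hnorm, hnorm]
  exact is_const_of_deriv_eq_zero (fun s => (hN s).differentiableAt) (fun s => (hN s).deriv) t 0
end

section
/- Conservation of energy for the generalized nonlinear Schrödinger equation with potential: Let d ≥ 1, let V : ℝ^d → ℝ be continuous and bounded, and let f : ℝ → ℝ be continuously differentiable. Define F(u) := (1/2)∫₀ᵘ f(ξ) dξ and, for a Schwartz function ψ on ℝ^d, the energy H(ψ) := ∫_{ℝ^d} [ (1/2)( ‖∇ψ(x)‖² + V(x)|ψ(x)|² ) − F(|ψ(x)|²) ] dx, where ‖∇ψ‖² = Σ_{k=1}^d |∂_{x_k}ψ|². Suppose ψ : ℝ → 𝓢(ℝ^d; ℂ) is continuously differentiable as a map into the Schwartz space and satisfies, for every t ∈ ℝ and x ∈ ℝ^d, i ∂ₜψ(t)(x) = −Δψ(t)(x) + V(x) ψ(t)(x) − f(|ψ(t)(x)|²) ψ(t)(x). Then t ↦ H(ψ(t)) is constant; i.e. H(ψ(t)) = H(ψ(0)) for all t. -/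
open MeasureTheory Filter

/-- The energy functional
`H(ψ) = ∫ [ (1/2)(‖∇ψ‖² + V|ψ|²) - F(|ψ|²) ]` with `F(u) = (1/2)∫₀ᵘ f`. -/
noncomputable def energyH (d : ℕ) (V : EuclideanSpace ℝ (Fin d) → ℝ) (f : ℝ → ℝ)
    (ψ : SchwartzMap (EuclideanSpace ℝ (Fin d)) ℂ) : ℝ :=
  ∫ x, ((1 / 2 : ℝ) *
      ((∑ k : Fin d, ‖fderiv ℝ (fun y => ψ y) x (EuclideanSpace.single k 1)‖ ^ 2)
        + V x * ‖ψ x‖ ^ 2)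
    - (1 / 2 : ℝ) * ∫ ξ in (0:ℝ)..(‖ψ x‖ ^ 2), f ξ)

open scoped LineDeriv SchwartzMap InnerProductSpace Topology

section SchwartzCurve

variable {E F : Type*} [NormedAddCommGroup E] [NormedSpace ℝ E]
  [NormedAddCommGroup F] [NormedSpace ℝ F]

/-- A continuous curve of Schwartz functions decays uniformly on compact sets of times. -/
lemma SchwartzMap.exists_norm_apply_le_rpow_of_isCompact {φ : ℝ → 𝓢(E, F)} (hφ : Continuous φ)
    {K : Set ℝ} (hK : IsCompact K) (n : ℕ) :
    ∃ C : ℝ, 0 ≤ C ∧ ∀ t ∈ K, ∀ x, ‖φ t x‖ ≤ C * (1 + ‖x‖) ^ (-(n : ℝ)) := by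
  have hq : Continuous (((Finset.Iic (n, 0)).sup
      fun m => SchwartzMap.seminorm ℝ m.1 m.2 : Seminorm ℝ 𝓢(E, F)) : 𝓢(E, F) → ℝ) :=
    Seminorm.continuous_finsetSup fun m _ => (schwartz_withSeminorms ℝ E F).continuous_seminorm m
  obtain ⟨C, hC⟩ := hK.exists_bound_of_continuousOn (hq.comp hφ).continuousOn
  refine ⟨2 ^ n * max C 0, by positivity, fun t ht x => ?_⟩
  have h := SchwartzMap.one_add_le_sup_seminorm_apply (𝕜 := ℝ) (m := (n, 0)) le_rfl le_rfl (φ t) x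
  rw [norm_iteratedFDeriv_zero] at h
  have hpos : 0 < (1 + ‖x‖) ^ n := by positivity
  rw [Real.rpow_neg (by positivity), Real.rpow_natCast, ← div_eq_mul_inv, le_div_iff₀ hpos,
    mul_comm]
  refine h.trans ?_
  gcongr
  exact (le_abs_self _).trans ((hC t ht).trans (le_max_left _ _))

/-- A derivative in the Schwartz topology is preserved by continuous linear maps followed by
evaluation at a point. -/
lemma SchwartzMap.hasDerivAt_clm_apply {φ : ℝ → 𝓢(E, F)} {φ' : 𝓢(E, F)} {t : ℝ}
    (h : Tendsto (fun s : ℝ => s⁻¹ • (φ (t + s) - φ t)) (𝓝[≠] 0) (𝓝 φ'))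
    (L : 𝓢(E, F) →L[ℝ] 𝓢(E, F)) (x : E) :
    HasDerivAt (fun s => L (φ s) x) (L φ' x) t := by
  rw [hasDerivAt_iff_tendsto_slope_zero]
  have hc : Continuous fun g : 𝓢(E, F) => L g x :=
    (continuous_eval_const (F := BoundedContinuousFunction E F) x).comp
      ((SchwartzMap.toBoundedContinuousFunctionCLM ℝ E F).continuous.comp L.continuous)
  refine ((hc.tendsto φ').comp h).congr fun s => ?_
  simp

end SchwartzCurve

section IntegrationByParts

variable {E F : Type*} [NormedAddCommGroup E] [NormedSpace ℝ E] [MeasurableSpace E] [BorelSpace E]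
  [FiniteDimensional ℝ E] {μ : Measure E} [μ.IsAddHaarMeasure]
  [NormedAddCommGroup F] [InnerProductSpace ℝ F]

lemma SchwartzMap.integrable_inner (f g : 𝓢(E, F)) : Integrable (fun x => ⟪f x, g x⟫_ℝ) μ :=
  (SchwartzMap.pairing (innerSL ℝ) f g).integrable

lemma SchwartzMap.integral_inner_lineDerivOp_add (f g : 𝓢(E, F)) (v : E) :
    ∫ x, (⟪f x, ∂_{v} g x⟫_ℝ + ⟪∂_{v} f x, g x⟫_ℝ) ∂μ = 0 := by
  rw [integral_add (f.integrable_inner _) (SchwartzMap.integrable_inner _ g)]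
  have h : ∫ x, ⟪f x, ∂_{v} g x⟫_ℝ ∂μ = -∫ x, ⟪∂_{v} f x, g x⟫_ℝ ∂μ :=
    SchwartzMap.integral_bilinear_lineDerivOp_right_eq_neg_left f g (innerSL ℝ) v
  rw [h, neg_add_cancel]

end IntegrationByParts

section Energy

variable {d : ℕ} (V : EuclideanSpace ℝ (Fin d) → ℝ) (f : ℝ → ℝ)

/-- The integrand of the energy functional. -/
noncomputable def energyDensity (ψ : 𝓢(EuclideanSpace ℝ (Fin d), ℂ))
    (x : EuclideanSpace ℝ (Fin d)) : ℝ :=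
  (1 / 2 : ℝ) *
      ((∑ k : Fin d, ‖∂_{EuclideanSpace.single k (1 : ℝ)} ψ x‖ ^ 2) + V x * ‖ψ x‖ ^ 2)
    - (1 / 2 : ℝ) * ∫ ξ in (0:ℝ)..(‖ψ x‖ ^ 2), f ξ

/-- The derivative of the energy density at `ψ` in the direction `φ`. -/
noncomputable def energyDensityDeriv (ψ φ : 𝓢(EuclideanSpace ℝ (Fin d), ℂ))
    (x : EuclideanSpace ℝ (Fin d)) : ℝ :=
  (∑ k : Fin d, ⟪∂_{EuclideanSpace.single k (1 : ℝ)} ψ x,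
      ∂_{EuclideanSpace.single k (1 : ℝ)} φ x⟫_ℝ)
    + V x * ⟪ψ x, φ x⟫_ℝ - f (‖ψ x‖ ^ 2) * ⟪ψ x, φ x⟫_ℝ

variable {V f}

lemma continuous_energyDensity (hV : Continuous V) (hf : Continuous f)
    (ψ : 𝓢(EuclideanSpace ℝ (Fin d), ℂ)) : Continuous (energyDensity V f ψ) := by
  have hG : Continuous fun u : ℝ => ∫ ξ in (0:ℝ)..u, f ξ :=
    intervalIntegral.continuous_primitive (fun a b => hf.intervalIntegrable a b) 0
  have h1 := ψ.continuous
  have h2 := fun k : Fin d => (∂_{EuclideanSpace.single k (1 : ℝ)} ψ).continuous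
  have h3 := hG.comp (h1.norm.pow 2)
  simp only [Function.comp_def] at h3
  unfold energyDensity
  fun_prop

lemma continuous_energyDensityDeriv (hV : Continuous V) (hf : Continuous f)
    (ψ φ : 𝓢(EuclideanSpace ℝ (Fin d), ℂ)) : Continuous (energyDensityDeriv V f ψ φ) := by
  have h1 := ψ.continuous
  have h2 := φ.continuous
  have h3 := fun k : Fin d => (∂_{EuclideanSpace.single k (1 : ℝ)} ψ).continuous
  have h4 := fun k : Fin d => (∂_{EuclideanSpace.single k (1 : ℝ)} φ).continuous
  unfold energyDensityDeriv
  fun_prop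

lemma integrable_energyDensity (hV : Continuous V) (hVbdd : ∃ M : ℝ, ∀ x, |V x| ≤ M)
    (hf : Continuous f) (ψ : 𝓢(EuclideanSpace ℝ (Fin d), ℂ)) :
    Integrable (energyDensity V f ψ) := by
  obtain ⟨M, hM⟩ := hVbdd
  obtain ⟨C, hC⟩ : ∃ C, ∀ x, ‖ψ x‖ ≤ C := ⟨_, ψ.norm_le_seminorm ℝ⟩
  obtain ⟨B, hB⟩ := isCompact_Icc.exists_bound_of_continuousOn (s := Set.Icc 0 (C ^ 2))
    hf.continuousOn
  have hsq (φ : 𝓢(EuclideanSpace ℝ (Fin d), ℂ)) : Integrable fun x => ‖φ x‖ ^ 2 := by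
    simpa only [real_inner_self_eq_norm_sq] using φ.integrable_inner φ
  refine Integrable.mono'
    (g := fun x => (1 / 2 : ℝ) * ((∑ k : Fin d, ‖∂_{EuclideanSpace.single k (1 : ℝ)} ψ x‖ ^ 2)
      + M * ‖ψ x‖ ^ 2) + (1 / 2 : ℝ) * (B * ‖ψ x‖ ^ 2)) ?_
    (continuous_energyDensity hV hf ψ).aestronglyMeasurable (Eventually.of_forall fun x => ?_)
  · exact (((integrable_finsetSum _ fun k _ => hsq _).add ((hsq ψ).const_mul M)).const_mul _).add
      (((hsq ψ).const_mul B).const_mul _)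
  · have hprim : |∫ ξ in (0:ℝ)..(‖ψ x‖ ^ 2), f ξ| ≤ B * ‖ψ x‖ ^ 2 := by
      have h := intervalIntegral.norm_integral_le_of_norm_le_const (a := (0:ℝ)) (b := ‖ψ x‖ ^ 2)
        (f := f) (C := B) fun ξ hξ => ?_
      · simpa [abs_of_nonneg (sq_nonneg ‖ψ x‖)] using h
      · rw [Set.uIoc_of_le (by positivity)] at hξ
        exact hB ξ ⟨hξ.1.le, hξ.2.trans (by gcongr; exact hC x)⟩
    have hpot : |V x * ‖ψ x‖ ^ 2| ≤ M * ‖ψ x‖ ^ 2 := by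
      rw [abs_mul, abs_of_nonneg (sq_nonneg ‖ψ x‖)]
      gcongr
      exact hM x
    have hgrad : 0 ≤ ∑ k : Fin d, ‖∂_{EuclideanSpace.single k (1 : ℝ)} ψ x‖ ^ 2 := by positivity
    rw [abs_le] at hprim hpot
    rw [Real.norm_eq_abs, energyDensity, abs_le]
    constructor <;> linarith

lemma hasDerivAt_energyDensity (hf : Continuous f)
    {ψ : ℝ → 𝓢(EuclideanSpace ℝ (Fin d), ℂ)} {φ : 𝓢(EuclideanSpace ℝ (Fin d), ℂ)} {t : ℝ}
    (h : Tendsto (fun s : ℝ => s⁻¹ • (ψ (t + s) - ψ t)) (𝓝[≠] 0) (𝓝 φ))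
    (x : EuclideanSpace ℝ (Fin d)) :
    HasDerivAt (fun s => energyDensity V f (ψ s) x) (energyDensityDeriv V f (ψ t) φ x) t := by
  have h0 := (SchwartzMap.hasDerivAt_clm_apply h (ContinuousLinearMap.id ℝ _) x).norm_sq
  simp only [ContinuousLinearMap.id_apply] at h0
  have hk (k : Fin d) := (SchwartzMap.hasDerivAt_clm_apply h
    (LineDeriv.lineDerivOpCLM ℝ _ (EuclideanSpace.single k (1 : ℝ))) x).norm_sq
  simp only [LineDeriv.lineDerivOpCLM_apply] at hk
  have hG : HasDerivAt (fun u : ℝ => ∫ ξ in (0:ℝ)..u, f ξ) (f (‖ψ t x‖ ^ 2)) (‖ψ t x‖ ^ 2) :=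
    intervalIntegral.integral_hasDerivAt_right (hf.intervalIntegrable _ _)
      (hf.stronglyMeasurableAtFilter _ _) hf.continuousAt
  refine ((((HasDerivAt.fun_sum fun k _ => hk k).add (h0.const_mul (V x))).const_mul
    (1 / 2 : ℝ)).sub ((hG.comp t h0).const_mul (1 / 2 : ℝ))).congr_deriv ?_
  rw [energyDensityDeriv, ← Finset.mul_sum]
  ring

/-- Along a solution of the Schrödinger equation, the time derivative of the energy density is a
sum of total space derivatives. -/
lemma energyDensityDeriv_eq_sum {ψ φ : 𝓢(EuclideanSpace ℝ (Fin d), ℂ)}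
    {x : EuclideanSpace ℝ (Fin d)}
    (h : Complex.I * φ x =
      -lap (fun y => ψ y) x + (V x : ℂ) * ψ x - (f (‖ψ x‖ ^ 2) : ℂ) * ψ x) :
    energyDensityDeriv V f ψ φ x =
      ∑ k : Fin d, (⟪∂_{EuclideanSpace.single k (1 : ℝ)} ψ x,
          ∂_{EuclideanSpace.single k (1 : ℝ)} φ x⟫_ℝ
        + ⟪∂_{EuclideanSpace.single k (1 : ℝ)} (∂_{EuclideanSpace.single k (1 : ℝ)} ψ) x,
          φ x⟫_ℝ) := by
  have hlap : lap (fun y => ψ y) x =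
      ∑ k : Fin d, ∂_{EuclideanSpace.single k (1 : ℝ)} (∂_{EuclideanSpace.single k (1 : ℝ)} ψ) x :=
    rfl
  have hI : ⟪Complex.I * φ x, φ x⟫_ℝ = 0 := by
    simp [Complex.inner]
    ring
  rw [h, hlap, inner_sub_left, inner_add_left, inner_neg_left, sum_inner,
    ← Complex.real_smul, ← Complex.real_smul, real_inner_smul_left, real_inner_smul_left] at hI
  rw [energyDensityDeriv, Finset.sum_add_distrib]
  linarith

/-- Local uniform domination of the time derivative of the energy density. -/
lemma exists_integrable_bound_energyDensityDeriv (hVbdd : ∃ M : ℝ, ∀ x, |V x| ≤ M)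
    (hf : Continuous f) {ψ φ : ℝ → 𝓢(EuclideanSpace ℝ (Fin d), ℂ)} (hψ : Continuous ψ)
    (hφ : Continuous φ) {K : Set ℝ} (hK : IsCompact K) :
    ∃ g : EuclideanSpace ℝ (Fin d) → ℝ, Integrable g ∧
      ∀ t ∈ K, ∀ x, ‖energyDensityDeriv V f (ψ t) (φ t) x‖ ≤ g x := by
  obtain ⟨M, hM⟩ := hVbdd
  have bdd {χ : ℝ → 𝓢(EuclideanSpace ℝ (Fin d), ℂ)} (hχ : Continuous χ) :
      ∃ C : ℝ, 0 ≤ C ∧ ∀ t ∈ K, ∀ x, ‖χ t x‖ ≤ C := by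
    simpa using SchwartzMap.exists_norm_apply_le_rpow_of_isCompact hχ hK 0
  have decay {χ : ℝ → 𝓢(EuclideanSpace ℝ (Fin d), ℂ)} (hχ : Continuous χ) :=
    SchwartzMap.exists_norm_apply_le_rpow_of_isCompact hχ hK (d + 1)
  have hD (k : Fin d) {χ : ℝ → 𝓢(EuclideanSpace ℝ (Fin d), ℂ)} (hχ : Continuous χ) :
      Continuous fun t => ∂_{EuclideanSpace.single k (1 : ℝ)} (χ t) :=
    (LineDeriv.lineDerivOpCLM ℝ _ (EuclideanSpace.single k (1 : ℝ))).continuous.comp hχ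
  obtain ⟨A, hA0, hA⟩ := bdd hψ
  obtain ⟨B, hB0, hB⟩ := decay hφ
  choose a ha0 ha using fun k => bdd (hD k hψ)
  choose b hb0 hb using fun k => decay (hD k hφ)
  obtain ⟨N, hN⟩ := isCompact_Icc.exists_bound_of_continuousOn (s := Set.Icc 0 (A ^ 2))
    hf.continuousOn
  set w : EuclideanSpace ℝ (Fin d) → ℝ := fun x => (1 + ‖x‖) ^ (-((d + 1 : ℕ) : ℝ))
  refine ⟨fun x => ((∑ k, a k * b k) + M * (A * B) + N * (A * B)) * w x, ?_, fun t ht x => ?_⟩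
  · refine Integrable.const_mul (integrable_one_add_norm ?_) _
    simp
  have hw0 : 0 ≤ w x := by positivity
  have pair {z z' : ℂ} {c c' : ℝ} (hc : 0 ≤ c) (hz : ‖z‖ ≤ c) (hz' : ‖z'‖ ≤ c' * w x) :
      |⟪z, z'⟫_ℝ| ≤ c * c' * w x :=
    (abs_real_inner_le_norm z z').trans
      ((mul_le_mul hz hz' (norm_nonneg _) hc).trans_eq (mul_assoc _ _ _).symm)
  have h0 := pair hA0 (hA t ht x) (hB t ht x)
  have hgrad : |∑ k : Fin d, ⟪∂_{EuclideanSpace.single k (1 : ℝ)} (ψ t) x,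
      ∂_{EuclideanSpace.single k (1 : ℝ)} (φ t) x⟫_ℝ| ≤ (∑ k, a k * b k) * w x := by
    rw [Finset.sum_mul]
    exact (Finset.abs_sum_le_sum_abs _ _).trans
      (Finset.sum_le_sum fun k _ => pair (ha0 k) (ha k t ht x) (hb k t ht x))
  have hpot : |V x * ⟪ψ t x, φ t x⟫_ℝ| ≤ M * (A * B * w x) := by
    rw [abs_mul]
    exact mul_le_mul (hM x) h0 (abs_nonneg _) ((abs_nonneg _).trans (hM x))
  have hnl : |f (‖ψ t x‖ ^ 2) * ⟪ψ t x, φ t x⟫_ℝ| ≤ N * (A * B * w x) := by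
    have hfN := hN (‖ψ t x‖ ^ 2) ⟨by positivity, by gcongr; exact hA t ht x⟩
    rw [abs_mul]
    exact mul_le_mul hfN h0 (abs_nonneg _) ((norm_nonneg _).trans hfN)
  rw [abs_le] at hgrad hpot hnl
  rw [Real.norm_eq_abs, energyDensityDeriv, abs_le]
  constructor <;> linarith

end Energy

/-- Conservation of energy for the generalized NLS `i ∂ₜψ = -Δψ + Vψ - f(|ψ|²)ψ`,
for solutions which are C¹ in time with values in Schwartz space. -/
theorem energy_conservation (d : ℕ) (hd : 1 ≤ d)
    (V : EuclideanSpace ℝ (Fin d) → ℝ) (hV : Continuous V)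
    (hVbdd : ∃ M : ℝ, ∀ x, |V x| ≤ M)
    (f : ℝ → ℝ) (hf : ContDiff ℝ 1 f)
    (ψ dψ : ℝ → SchwartzMap (EuclideanSpace ℝ (Fin d)) ℂ)
    (hψc : Continuous ψ) (hdψc : Continuous dψ)
    (hderiv : ∀ t : ℝ, Tendsto (fun h : ℝ => h⁻¹ • (ψ (t + h) - ψ t))
      (nhdsWithin 0 {0}ᶜ) (nhds (dψ t)))
    (heq : ∀ (t : ℝ) (x : EuclideanSpace ℝ (Fin d)),
      Complex.I * dψ t x =
        -lap (fun y => ψ t y) x + (V x : ℂ) * ψ t x - (f (‖ψ t x‖ ^ 2) : ℂ) * ψ t x) :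
    ∀ t : ℝ, energyH d V f (ψ t) = energyH d V f (ψ 0) := by
  have key (t : ℝ) : HasDerivAt (fun s => energyH d V f (ψ s)) 0 t := by
    obtain ⟨g, hg, hbound⟩ := exists_integrable_bound_energyDensityDeriv hVbdd hf.continuous
      hψc hdψc (isCompact_closedBall t 1)
    have h := (hasDerivAt_integral_of_dominated_loc_of_deriv_le (μ := volume)
      (F := fun s => energyDensity V f (ψ s))
      (F' := fun s => energyDensityDeriv V f (ψ s) (dψ s))
      (Metric.closedBall_mem_nhds t one_pos)
      (Eventually.of_forall fun s =>
        (continuous_energyDensity hV hf.continuous (ψ s)).aestronglyMeasurable)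
      (integrable_energyDensity hV hVbdd hf.continuous (ψ t))
      (continuous_energyDensityDeriv hV hf.continuous _ _).aestronglyMeasurable
      (Eventually.of_forall fun x s hs => hbound s hs x) hg
      (Eventually.of_forall fun x s _ =>
        hasDerivAt_energyDensity hf.continuous (hderiv s) x)).2
    refine h.congr_deriv ?_
    simp_rw [fun x => energyDensityDeriv_eq_sum (heq t x)]
    rw [integral_finsetSum]
    swap
    · exact fun k _ =>
        (SchwartzMap.integrable_inner _ _).add (SchwartzMap.integrable_inner _ _)
    exact Finset.sum_eq_zero fun k _ => SchwartzMap.integral_inner_lineDerivOp_add _ _ _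
  exact fun t => is_const_of_deriv_eq_zero (fun t => (key t).differentiableAt)
    (fun t => (key t).deriv) t 0
end

section
/- Invariance of the normal form under polynomial changes of variables: Let N ≥ 1 be an integer and T₀ ≥ 1, C₀ > 0. Let ε : ℝ → ℝ be continuously differentiable with bounded values and derivative. For each pair of natural numbers (m,n) with 2 ≤ m+n ≤ 2N+1 let Θ_{m,n}, Λ_{m,n} : ℝ → ℂ be continuously differentiable with bounded values and derivatives, and assume: Θ_{m,n}(s) and Λ_{m,n}(s) are purely imaginary for all s whenever m ≤ N and n ≤ N, and Θ_{m,n} ≡ 0 whenever m+n ≤ N and m ≠ n+1. For N+1 ≤ m+n ≤ 2N+1 let p_{m,n} : ℝ → ℂ be continuously differentiable with bounded values and derivatives, real-valued whenever m ≤ N and n ≤ N. Let y : [0,∞) → ℂ and λ : [0,∞) → ℝ be continuously differentiable with |y(t)| ≤ C₀ (T₀+t)^{−1/(2N)} and, for all t ≥ 0, | y'(t) − i ε(λ(t)) y(t) − Σ_{2≤m+n≤2N+1} Θ_{m,n}(λ(t)) y(t)^m conj(y(t))^n | ≤ C₀ (T₀+t)^{−(2N+2)/(2N)} and | λ'(t)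 − Σ_{2≤m+n≤2N+1} Λ_{m,n}(λ(t)) y(t)^m conj(y(t))^n | ≤ C₀ (T₀+t)^{−(2N+2)/(2N)}. Define β(t) := y(t) + Σ_{N+1≤m+n≤2N+1} p_{m,n}(λ(t)) y(t)^m conj(y(t))^n. Then there exist bounded functions Θ^{(1)}_{m,n}, Λ^{(1)}_{m,n} : ℝ → ℂ for 2 ≤ m+n ≤ 2N+1, with Θ^{(1)}_{m,n}(s) and Λ^{(1)}_{m,n}(s) purely imaginary for all s whenever m ≤ N and n ≤ N, and Θ^{(1)}_{m,n} ≡ 0 whenever m+n ≤ N and m ≠ n+1, and a constant C > 0, such that for all t ≥ 0: | β'(t) − i ε(λ(t)) β(t) − Σ_{2≤m+n≤2N+1} Θ^{(1)}_{m,n}(λ(t)) β(t)^m conj(β(t))^n | ≤ C (T₀+t)^{−(2N+2)/(2N)} and | λ'(t) − Σ_{2≤m+n≤2N+1} Λ^{(1)}_{m,n}(λ(t)) β(t)^m conj(β(t))^n | ≤ C (T₀+t)^{−(2N+2)/(2N)}. -/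
open Finset

/-- The set of pairs `(m,n)` of natural numbers with `lo ≤ m + n ≤ hi`. -/
def pairSet (lo hi : ℕ) : Finset (ℕ × ℕ) :=
  (Finset.range (hi + 1) ×ˢ Finset.range (hi + 1)).filter
    fun p => lo ≤ p.1 + p.2 ∧ p.1 + p.2 ≤ hi

section AsymptoticExpansion

open MvPolynomial
open scoped BoundedContinuousFunction ComplexConjugate

/-- Evaluation of bounded continuous functions at a point, as a ring homomorphism. -/
noncomputable def pointEval (s : ℝ) : (ℝ →ᵇ ℂ) →+* ℂ where
  toFun q := q s
  map_one' := rfl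
  map_mul' _ _ := rfl
  map_zero' := rfl
  map_add' _ _ := rfl

@[simp]
theorem pointEval_apply (s : ℝ) (q : ℝ →ᵇ ℂ) : pointEval s q = q s := rfl

/-- The value at `(w, conj w)` of a polynomial in two variables whose coefficients are evaluated
at `s`. -/
noncomputable def polyEval (s : ℝ) (w : ℂ) : MvPolynomial (Fin 2) (ℝ →ᵇ ℂ) →+* ℂ :=
  eval₂Hom (pointEval s) ![w, conj w]

theorem polyEval_eq_sum (s : ℝ) (w : ℂ) (G : MvPolynomial (Fin 2) (ℝ →ᵇ ℂ)) :
    polyEval s w G = ∑ e ∈ G.support, coeff e G s * (w ^ e 0 * conj w ^ e 1) := by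
  simp [polyEval, eval₂_eq', Fin.prod_univ_two]

@[simp]
theorem polyEval_C (s : ℝ) (w : ℂ) (q : ℝ →ᵇ ℂ) : polyEval s w (C q) = q s := by
  simp [polyEval]

@[simp]
theorem polyEval_X_zero (s : ℝ) (w : ℂ) : polyEval s w (X 0) = w := by
  simp [polyEval]

theorem polyEval_monomial (s : ℝ) (w : ℂ) (e : Fin 2 →₀ ℕ) (q : ℝ →ᵇ ℂ) :
    polyEval s w (monomial e q) = q s * (w ^ e 0 * conj w ^ e 1) := by
  simp [polyEval, eval₂_monomial, Finsupp.prod_fintype, Fin.prod_univ_two]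

/-- `τ` takes values in `[0, 1]` and `w = O(τ)` on `[0, ∞)`. -/
structure IsSmall (τ : ℝ → ℝ) (w : ℝ → ℂ) : Prop where
  nonneg : ∀ t, 0 ≤ t → 0 ≤ τ t
  le_one : ∀ t, 0 ≤ t → τ t ≤ 1
  bound : ∃ B, 0 ≤ B ∧ ∀ t, 0 ≤ t → ‖w t‖ ≤ B * τ t

/-- `f` equals, up to an error `O(τ ^ K)` on `[0, ∞)`, a polynomial in `w` and `conj w` with bounded
continuous coefficients evaluated along `lam`; the coefficient of `w ^ m * conj w ^ n` takes its
values in `S m n`. -/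
def HasExpansion (lam τ : ℝ → ℝ) (w : ℝ → ℂ) (K : ℕ) (S : ℕ → ℕ → AddSubgroup ℂ)
    (f : ℝ → ℂ) : Prop :=
  ∃ (G : MvPolynomial (Fin 2) (ℝ →ᵇ ℂ)) (B : ℝ), 0 ≤ B ∧
    (∀ e s, coeff e G s ∈ S (e 0) (e 1)) ∧
    ∀ t, 0 ≤ t → ‖f t - polyEval (lam t) (w t) G‖ ≤ B * τ t ^ K

variable {lam τ : ℝ → ℝ} {w : ℝ → ℂ} {K L J a b : ℕ} {S S₁ S₂ : ℕ → ℕ → AddSubgroup ℂ}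
  {f g : ℝ → ℂ}

theorem IsSmall.exists_norm_polyEval_le (h : IsSmall τ w) (lam : ℝ → ℝ)
    {G : MvPolynomial (Fin 2) (ℝ →ᵇ ℂ)} (hG : ∀ e : Fin 2 →₀ ℕ, e 0 + e 1 < a → coeff e G = 0) :
    ∃ B, 0 ≤ B ∧ ∀ t, 0 ≤ t → ‖polyEval (lam t) (w t) G‖ ≤ B * τ t ^ a := by
  obtain ⟨B, hB, hw⟩ := h.bound
  refine ⟨∑ e ∈ G.support, ‖coeff e G‖ * B ^ (e 0 + e 1), by positivity, fun t ht => ?_⟩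
  rw [polyEval_eq_sum, Finset.sum_mul]
  refine (norm_sum_le _ _).trans (Finset.sum_le_sum fun e he => ?_)
  have hdeg : a ≤ e 0 + e 1 := by
    by_contra hlt
    exact (mem_support_iff.mp he) (hG e (not_le.mp hlt))
  have hτ := h.nonneg t ht
  calc ‖coeff e G (lam t) * (w t ^ e 0 * conj (w t) ^ e 1)‖
      = ‖coeff e G (lam t)‖ * ‖w t‖ ^ (e 0 + e 1) := by
        simp [pow_add]
    _ ≤ ‖coeff e G‖ * (B * τ t) ^ (e 0 + e 1) := by
        gcongr
        · exact (coeff e G).norm_coe_le_norm _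
        · exact hw t ht
    _ = ‖coeff e G‖ * B ^ (e 0 + e 1) * τ t ^ (e 0 + e 1) := by rw [mul_pow]; ring
    _ ≤ ‖coeff e G‖ * B ^ (e 0 + e 1) * τ t ^ a := by
        gcongr ?_ * ?_
        exact pow_le_pow_of_le_one hτ (h.le_one t ht) hdeg

theorem coeff_eq_zero_of_forall_mem {G : MvPolynomial (Fin 2) (ℝ →ᵇ ℂ)}
    (hG : ∀ e s, coeff e G s ∈ S (e 0) (e 1)) (hS : ∀ m n, m + n < a → S m n ≤ ⊥)
    (e : Fin 2 →₀ ℕ) (he : e 0 + e 1 < a) : coeff e G = 0 := by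
  ext s
  exact AddSubgroup.mem_bot.mp (hS _ _ he (hG e s))

theorem HasExpansion.mono (h : IsSmall τ w) (hf : HasExpansion lam τ w K S f) (hL : L ≤ K)
    (hS : ∀ m n, S m n ≤ S₁ m n) : HasExpansion lam τ w L S₁ f := by
  obtain ⟨G, B, hB, hG, hfG⟩ := hf
  refine ⟨G, B, hB, fun e s => hS _ _ (hG e s), fun t ht => (hfG t ht).trans ?_⟩
  gcongr ?_ * ?_
  exact pow_le_pow_of_le_one (h.nonneg t ht) (h.le_one t ht) hL

theorem HasExpansion.congr (hf : HasExpansion lam τ w K S f)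
    (hfg : ∃ B, 0 ≤ B ∧ ∀ t, 0 ≤ t → ‖g t - f t‖ ≤ B * τ t ^ K) :
    HasExpansion lam τ w K S g := by
  obtain ⟨G, B, hB, hG, hfG⟩ := hf
  obtain ⟨B', hB', hfg⟩ := hfg
  refine ⟨G, B' + B, by positivity, hG, fun t ht => ?_⟩
  rw [add_mul]
  exact (norm_sub_le_norm_sub_add_norm_sub _ (f t) _).trans (add_le_add (hfg t ht) (hfG t ht))

theorem hasExpansion_zero : HasExpansion lam τ w K S (fun _ => 0) :=
  ⟨0, 0, le_rfl, fun e s => by simp, fun t _ => by simp⟩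

theorem HasExpansion.add (hf : HasExpansion lam τ w K S f) (hg : HasExpansion lam τ w K S g) :
    HasExpansion lam τ w K S (fun t => f t + g t) := by
  obtain ⟨F, B, hB, hF, hfF⟩ := hf
  obtain ⟨G, B', hB', hG, hgG⟩ := hg
  refine ⟨F + G, B + B', by positivity, fun e s => ?_, fun t ht => ?_⟩
  · simpa using add_mem (hF e s) (hG e s)
  · rw [map_add, add_mul, add_sub_add_comm]
    exact (norm_add_le _ _).trans (add_le_add (hfF t ht) (hgG t ht))

theorem HasExpansion.neg (hf : HasExpansion lam τ w K S f) :
    HasExpansion lam τ w K S (fun t => -f t) := by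
  obtain ⟨F, B, hB, hF, hfF⟩ := hf
  refine ⟨-F, B, hB, fun e s => ?_, fun t ht => ?_⟩
  · simpa using hF e s
  · rw [map_neg, neg_sub_neg, norm_sub_rev]
    exact hfF t ht

theorem HasExpansion.sum {ι : Type*} {s : Finset ι} {F : ι → ℝ → ℂ}
    (hF : ∀ i ∈ s, HasExpansion lam τ w K S (F i)) :
    HasExpansion lam τ w K S (fun t => ∑ i ∈ s, F i t) := by
  classical
  induction s using Finset.induction_on with
  | empty => simpa using hasExpansion_zero
  | insert i s hi ih =>
    simp only [Finset.sum_insert hi]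
    exact (hF i (Finset.mem_insert_self _ _)).add
      (ih fun j hj => hF j (Finset.mem_insert_of_mem hj))

theorem HasExpansion.exists_norm_le (h : IsSmall τ w) (hf : HasExpansion lam τ w K S f)
    (hS : ∀ m n, m + n < a → S m n ≤ ⊥) (ha : a ≤ K) :
    ∃ B, 0 ≤ B ∧ ∀ t, 0 ≤ t → ‖f t‖ ≤ B * τ t ^ a := by
  obtain ⟨F, B, hB, hF, hfF⟩ := hf.mono h ha fun _ _ => le_rfl
  obtain ⟨B', hB', hF'⟩ := h.exists_norm_polyEval_le lam (coeff_eq_zero_of_forall_mem hF hS)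
  refine ⟨B + B', by positivity, fun t ht => ?_⟩
  rw [add_mul]
  exact (norm_le_norm_sub_add _ _).trans (add_le_add (hfF t ht) (hF' t ht))

/-- The error of a product of two expansions takes into account the orders `a`, `b` of vanishing of
the factors. -/
theorem HasExpansion.mul (h : IsSmall τ w) (hf : HasExpansion lam τ w K S₁ f)
    (hg : HasExpansion lam τ w L S₂ g) (hS₁ : ∀ m n, m + n < a → S₁ m n ≤ ⊥)
    (hS₂ : ∀ m n, m + n < b → S₂ m n ≤ ⊥) (hbL : b ≤ L) (hJK : J ≤ K + b) (hJL : J ≤ a + L)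
    (hS : ∀ m n m' n', ∀ x ∈ S₁ m n, ∀ z ∈ S₂ m' n', x * z ∈ S (m + m') (n + n')) :
    HasExpansion lam τ w J S (fun t => f t * g t) := by
  obtain ⟨B₂, hB₂, hg₂⟩ := hg.exists_norm_le h hS₂ hbL
  obtain ⟨F, B, hB, hF, hfF⟩ := hf
  obtain ⟨G, B', hB', hG, hgG⟩ := hg
  obtain ⟨B₁, hB₁, hF₁⟩ := h.exists_norm_polyEval_le lam (coeff_eq_zero_of_forall_mem hF hS₁)
  refine ⟨F * G, B * B₂ + B₁ * B', by positivity, fun e s => ?_, fun t ht => ?_⟩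
  · rw [coeff_mul, BoundedContinuousFunction.sum_apply]
    refine sum_mem fun x hx => ?_
    have hxe := Finset.HasAntidiagonal.mem_antidiagonal.mp hx
    have := hS _ _ _ _ _ (hF x.1 s) _ (hG x.2 s)
    rwa [← Finsupp.add_apply, ← Finsupp.add_apply, hxe] at this
  · have hτ := h.nonneg t ht
    have hτ₁ := h.le_one t ht
    have hsplit : f t * g t - polyEval (lam t) (w t) (F * G) =
        (f t - polyEval (lam t) (w t) F) * g t +
          polyEval (lam t) (w t) F * (g t - polyEval (lam t) (w t) G) := by
      rw [map_mul]; ring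
    rw [hsplit]
    calc _ ≤ B * τ t ^ K * (B₂ * τ t ^ b) + B₁ * τ t ^ a * (B' * τ t ^ L) := by
          refine (norm_add_le _ _).trans ?_
          rw [norm_mul, norm_mul]
          gcongr
          · exact hfF t ht
          · exact hg₂ t ht
          · exact hF₁ t ht
          · exact hgG t ht
      _ = B * B₂ * τ t ^ (K + b) + B₁ * B' * τ t ^ (a + L) := by rw [pow_add, pow_add]; ring
      _ ≤ B * B₂ * τ t ^ J + B₁ * B' * τ t ^ J := by
          gcongr ?_ * ?_ + ?_ * ?_
          · exact pow_le_pow_of_le_one hτ hτ₁ hJK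
          · exact pow_le_pow_of_le_one hτ hτ₁ hJL
      _ = (B * B₂ + B₁ * B') * τ t ^ J := by ring

theorem HasExpansion.const_mul (h : IsSmall τ w) {q : ℝ → ℂ} (hq : Continuous q)
    (hqM : ∃ M, ∀ s, ‖q s‖ ≤ M) (hf : HasExpansion lam τ w K S₁ f)
    (hS : ∀ m n s, ∀ x ∈ S₁ m n, q s * x ∈ S m n) :
    HasExpansion lam τ w K S (fun t => q (lam t) * f t) := by
  obtain ⟨M, hM⟩ := hqM
  let Q : ℝ →ᵇ ℂ := .ofNormedAddCommGroup q hq M hM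
  obtain ⟨F, B, hB, hF, hfF⟩ := hf
  refine ⟨C Q * F, ‖Q‖ * B, by positivity, fun e s => ?_, fun t ht => ?_⟩
  · rw [coeff_C_mul]
    exact hS _ _ _ _ (hF e s)
  · have hτ := h.nonneg t ht
    rw [map_mul, polyEval_C, show Q (lam t) = q (lam t) from rfl, ← mul_sub, norm_mul, mul_assoc]
    gcongr
    · exact Q.norm_coe_le_norm (lam t)
    · exact hfF t ht

theorem hasExpansion_one (hS : 1 ∈ S 0 0) : HasExpansion lam τ w K S (fun _ => 1) := by
  refine ⟨1, 0, le_rfl, fun e s => ?_, fun t _ => by simp⟩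
  rw [coeff_one]
  split_ifs with he
  · subst he; exact hS
  · exact zero_mem _

theorem hasExpansion_self (hS : 1 ∈ S 1 0) : HasExpansion lam τ w K S w := by
  refine ⟨X 0, 0, le_rfl, fun e s => ?_, fun t _ => by simp⟩
  rw [coeff_X]
  split_ifs with he
  · subst he; simpa using hS
  · exact zero_mem _

theorem HasExpansion.conj (hf : HasExpansion lam τ w K S₁ f)
    (hS : ∀ m n, ∀ x ∈ S₁ m n, conj x ∈ S n m) :
    HasExpansion lam τ w K S (fun t => conj (f t)) := by
  obtain ⟨F, B, hB, hF, hfF⟩ := hf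
  refine ⟨map (starRingEnd (ℝ →ᵇ ℂ)) (rename (Equiv.swap 0 1) F), B, hB, fun e s => ?_,
    fun t ht => ?_⟩
  · obtain ⟨d, rfl⟩ : ∃ d, Finsupp.mapDomain (Equiv.swap (0 : Fin 2) 1) d = e :=
      ⟨Finsupp.mapDomain (Equiv.swap 0 1) e, by
        rw [← Finsupp.mapDomain_comp]
        convert Finsupp.mapDomain_id
        ext i; simp⟩
    rw [coeff_map, coeff_rename_mapDomain _ (Equiv.injective _)]
    simp only [Finsupp.mapDomain_equiv_apply, Equiv.symm_swap, Equiv.swap_apply_left,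
      Equiv.swap_apply_right]
    exact hS _ _ _ (hF d s)
  · have hconj : polyEval (lam t) (w t) (map (starRingEnd (ℝ →ᵇ ℂ))
        (rename (Equiv.swap 0 1) F)) = conj (polyEval (lam t) (w t) F) := by
      simp only [polyEval, coe_eval₂Hom, eval₂_map, eval₂_rename]
      rw [eval₂_comp_left]
      congr 1
      ext i
      fin_cases i <;> simp
    rw [hconj, ← map_sub, Complex.norm_conj]
    exact hfF t ht

/-- An expansion may be truncated at its order of accuracy. -/
theorem HasExpansion.exists_sum_pairSet (h : IsSmall τ w) (hf : HasExpansion lam τ w (K + 1) S f)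
    (hS : ∀ m n, m + n < a → S m n ≤ ⊥) :
    ∃ (c : ℕ → ℕ → ℝ → ℂ) (B : ℝ), 0 ≤ B ∧ (∀ m n, ∃ M, ∀ s, ‖c m n s‖ ≤ M) ∧
      (∀ m n s, c m n s ∈ S m n) ∧
      ∀ t, 0 ≤ t → ‖f t - ∑ p ∈ pairSet a K,
        c p.1 p.2 (lam t) * w t ^ p.1 * conj (w t) ^ p.2‖ ≤ B * τ t ^ (K + 1) := by
  obtain ⟨F, B, hB, hF, hfF⟩ := hf
  let e : ℕ × ℕ → Fin 2 →₀ ℕ := fun p => Finsupp.equivFunOnFinite.symm ![p.1, p.2]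
  have he0 : ∀ p, e p 0 = p.1 := fun p => rfl
  have he1 : ∀ p, e p 1 = p.2 := fun p => rfl
  let T : MvPolynomial (Fin 2) (ℝ →ᵇ ℂ) := ∑ p ∈ pairSet a K, monomial (e p) (coeff (e p) F)
  have hT : ∀ d : Fin 2 →₀ ℕ, d 0 + d 1 < K + 1 → coeff d (F - T) = 0 := by
    intro d hd
    have hd' : e (d 0, d 1) = d := by
      ext i; fin_cases i <;> rfl
    have hcoeff : coeff d T = if (d 0, d 1) ∈ pairSet a K then coeff d F else 0 := by
      rw [show coeff d T = ∑ p ∈ pairSet a K, if e p = d then coeff (e p) F else 0 by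
        simp [T, coeff_sum, coeff_monomial]]
      rw [← Finset.sum_ite_eq (pairSet a K) (d 0, d 1) fun _ => coeff d F]
      refine Finset.sum_congr rfl fun p _ => ?_
      by_cases hp : e p = d
      · rw [if_pos hp, hp, if_pos (by subst hp; rfl)]
      · rw [if_neg hp, if_neg (by rintro rfl; exact hp hd')]
    rw [coeff_sub, hcoeff]
    split_ifs with hmem
    · exact sub_self _
    · rw [sub_zero]
      refine coeff_eq_zero_of_forall_mem hF hS d ?_
      by_contra hlt
      exact hmem (by simp [pairSet]; omega)
  obtain ⟨B', hB', hFT⟩ := h.exists_norm_polyEval_le lam hT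
  refine ⟨fun m n s => coeff (e (m, n)) F s, B + B', by positivity,
    fun m n => ⟨_, (coeff (e (m, n)) F).norm_coe_le_norm⟩, fun m n s => hF (e (m, n)) s,
    fun t ht => ?_⟩
  have hTt : ∑ p ∈ pairSet a K, coeff (e (p.1, p.2)) F (lam t) * w t ^ p.1 * conj (w t) ^ p.2 =
      polyEval (lam t) (w t) T := by
    simp only [T, map_sum, polyEval_monomial, he0, he1, mul_assoc]
  have hFTt := hFT t ht
  rw [map_sub] at hFTt
  rw [hTt, add_mul]
  exact (norm_sub_le_norm_sub_add_norm_sub _ _ _).trans (add_le_add (hfF t ht) hFTt)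

end AsymptoticExpansion

section NormalForm

open scoped ComplexConjugate

/-- The complex numbers that vanish if `Z m n` holds and lie in the kernel of `φ` if `R m n`
holds. -/
def coeffClass (Z R : ℕ → ℕ → Prop) (φ : ℂ →ₗ[ℝ] ℝ) (m n : ℕ) : AddSubgroup ℂ where
  carrier := {x | (Z m n → x = 0) ∧ (R m n → φ x = 0)}
  zero_mem' := by simp
  add_mem' := by
    rintro x z ⟨hx, hx'⟩ ⟨hz, hz'⟩
    exact ⟨fun h => by rw [hx h, hz h, add_zero], fun h => by rw [map_add, hx' h, hz' h, add_zero]⟩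
  neg_mem' := by
    rintro x ⟨hx, hx'⟩
    exact ⟨fun h => by rw [hx h, neg_zero], fun h => by rw [map_neg, hx' h, neg_zero]⟩

theorem mem_coeffClass {Z R : ℕ → ℕ → Prop} {φ : ℂ →ₗ[ℝ] ℝ} {m n : ℕ} {x : ℂ} :
    x ∈ coeffClass Z R φ m n ↔ (Z m n → x = 0) ∧ (R m n → φ x = 0) := Iff.rfl

theorem coeffClass_le_bot {Z R : ℕ → ℕ → Prop} {φ : ℂ →ₗ[ℝ] ℝ} {m n : ℕ} (h : Z m n) :
    coeffClass Z R φ m n ≤ ⊥ := fun _ hx => AddSubgroup.mem_bot.mpr (hx.1 h)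

theorem coeffClass_mono {Z Z' R R' : ℕ → ℕ → Prop} {φ : ℂ →ₗ[ℝ] ℝ} {m n : ℕ}
    (hZ : Z' m n → Z m n) (hR : R' m n → Z m n ∨ R m n) :
    coeffClass Z R φ m n ≤ coeffClass Z' R' φ m n := fun _ hx =>
  ⟨fun h => hx.1 (hZ h), fun h => (hR h).elim (fun h => by rw [hx.1 h, map_zero]) hx.2⟩

theorem map_mul_eq_zero_of_im_eq_zero (φ : ℂ →ₗ[ℝ] ℝ) {z x : ℂ} (hz : φ z = 0) (hx : x.im = 0) :
    φ (z * x) = 0 := by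
  have hzx : z * x = x.re • z := by
    rw [Complex.real_smul, mul_comm]
    congr 1
    exact Complex.ext rfl hx
  rw [hzx, map_smul, hz, smul_zero]

/-- Both exponents are at most `N`. -/
def InBox (N m n : ℕ) : Prop := m ≤ N ∧ n ≤ N

/-- The exponents that do not occur in the expansion of `y ^ a * conj y ^ b` when `y` is a
perturbation of the identity by terms of degree at least `N + 1`. -/
def OffMonomial (N a b m n : ℕ) : Prop := (m ≠ a ∨ n ≠ b) ∧ m + n < a + b + N

/-- The exponents that do not occur in the normal form. -/
def NonResonant (N m n : ℕ) : Prop := m + n < 2 ∨ m + n ≤ N ∧ m ≠ n + 1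

/-- The class of expansions of `y ^ a * conj y ^ b`. -/
abbrev monomialClass (N a b : ℕ) : ℕ → ℕ → AddSubgroup ℂ :=
  coeffClass (OffMonomial N a b) (InBox N) Complex.imLm

variable {lam τ : ℝ → ℝ} {w y f z : ℝ → ℂ} {N K J k a b lo hi : ℕ} {φ : ℂ →ₗ[ℝ] ℝ}
  {Z : ℕ → ℕ → Prop}

theorem monomialClass_le_bot (m n : ℕ) (h : m + n < a + b) : monomialClass N a b m n ≤ ⊥ :=
  coeffClass_le_bot ⟨by omega, by omega⟩

theorem mul_mem_monomialClass {a' b' : ℕ} (m n m' n' : ℕ) (x : ℂ) (hx : x ∈ monomialClass N a b m n)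
    (z : ℂ) (hz : z ∈ monomialClass N a' b' m' n') :
    x * z ∈ monomialClass N (a + a') (b + b') (m + m') (n + n') := by
  simp only [mem_coeffClass, OffMonomial, InBox, Complex.imLm_coe] at hx hz ⊢
  refine ⟨fun h => ?_, fun h => ?_⟩
  · rw [mul_eq_zero]
    by_contra! hne
    have h₁ := mt hx.1 hne.1
    have h₂ := mt hz.1 hne.2
    omega
  · rw [Complex.mul_im, hx.2 (by omega), hz.2 (by omega)]
    simp

theorem HasExpansion.monomial (h : IsSmall τ w)
    (hy : HasExpansion lam τ w (k + 1) (monomialClass N 1 0) y) (a b : ℕ) :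
    HasExpansion lam τ w (k + (a + b)) (monomialClass N a b)
      (fun t => y t ^ a * conj (y t) ^ b) := by
  have hpow : ∀ a, HasExpansion lam τ w (k + a) (monomialClass N a 0) (fun t => y t ^ a) := by
    intro a
    induction a with
    | zero =>
      simp only [pow_zero]
      exact hasExpansion_one (by simp [mem_coeffClass, OffMonomial])
    | succ a ih =>
      simp only [pow_succ]
      exact ih.mul h hy (a := a) (b := 1) (fun m n hmn => monomialClass_le_bot m n (by omega))
        (fun m n hmn => monomialClass_le_bot m n (by omega)) (by omega) (by omega)
        (by omega) mul_mem_monomialClass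
  have hconj : HasExpansion lam τ w (k + b) (monomialClass N 0 b) (fun t => conj (y t) ^ b) := by
    simp only [← map_pow]
    refine (hpow b).conj fun m n x hx => ?_
    simp only [mem_coeffClass, OffMonomial, InBox, Complex.imLm_coe] at hx ⊢
    refine ⟨fun h => ?_, fun h => ?_⟩
    · rw [hx.1 (by omega), map_zero]
    · rw [Complex.conj_im, hx.2 (by omega), neg_zero]
  have := (hpow a).mul h hconj (a := a) (b := b) (J := k + (a + b))
    (fun m n hmn => monomialClass_le_bot m n (by omega))
    (fun m n hmn => monomialClass_le_bot m n (by omega)) (by omega) (by omega) (by omega)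
    mul_mem_monomialClass
  simpa using this

theorem HasExpansion.coeff_mul_monomial (h : IsSmall τ w)
    (hf : HasExpansion lam τ w K (monomialClass N a b) f) {q : ℝ → ℂ} (hq : Continuous q)
    (hqM : ∃ M, ∀ s, ‖q s‖ ≤ M) (hq0 : Z a b → ∀ s, q s = 0)
    (hqφ : a ≤ N → b ≤ N → ∀ s, φ (q s) = 0) (hZ : ∀ m n, Z m n → m + n < a + b + N) :
    HasExpansion lam τ w K (coeffClass Z (InBox N) φ) (fun t => q (lam t) * f t) := by
  refine hf.const_mul h hq hqM fun m n s x hx => ?_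
  simp only [mem_coeffClass, OffMonomial, InBox, Complex.imLm_coe] at hx ⊢
  by_cases hmn : m = a ∧ n = b
  · obtain ⟨rfl, rfl⟩ := hmn
    exact ⟨fun h => by rw [hq0 h, zero_mul],
      fun h => map_mul_eq_zero_of_im_eq_zero φ (hqφ h.1 h.2 s) (hx.2 h)⟩
  · refine ⟨fun h => ?_, fun h => ?_⟩
    · rw [hx.1 ⟨by omega, hZ m n h⟩, mul_zero]
    · by_cases hlt : m + n < a + b + N
      · rw [hx.1 ⟨by omega, hlt⟩, mul_zero, map_zero]
      · exact map_mul_eq_zero_of_im_eq_zero φ (hqφ (by omega) (by omega) s) (hx.2 h)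

theorem mem_pairSet {p : ℕ × ℕ} : p ∈ pairSet lo hi ↔ lo ≤ p.1 + p.2 ∧ p.1 + p.2 ≤ hi := by
  simp only [pairSet, Finset.mem_filter, Finset.mem_product, Finset.mem_range]
  omega

theorem HasExpansion.sum_pairSet (h : IsSmall τ w)
    (hy : HasExpansion lam τ w (k + 1) (monomialClass N 1 0) y) {Q : ℕ → ℕ → ℝ → ℂ}
    (hQ : ∀ m n, lo ≤ m + n → m + n ≤ hi → Continuous (Q m n) ∧ ∃ M, ∀ s, ‖Q m n s‖ ≤ M)
    (hQ0 : ∀ m n, lo ≤ m + n → Z m n → ∀ s, Q m n s = 0)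
    (hQφ : ∀ m n, m ≤ N → n ≤ N → ∀ s, φ (Q m n s) = 0)
    (hZ : ∀ m n, Z m n → m + n < lo + N) (hJ : J ≤ k + lo) :
    HasExpansion lam τ w J (coeffClass Z (InBox N) φ)
      (fun t => ∑ p ∈ pairSet lo hi, Q p.1 p.2 (lam t) * y t ^ p.1 * conj (y t) ^ p.2) := by
  refine HasExpansion.sum fun p hp => ?_
  obtain ⟨hlo, hhi⟩ := mem_pairSet.mp hp
  obtain ⟨hc, hM⟩ := hQ p.1 p.2 hlo hhi
  simp only [mul_assoc]
  exact ((hy.monomial h p.1 p.2).coeff_mul_monomial h hc hM (hQ0 _ _ hlo) (hQφ _ _)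
    fun m n hmn => (hZ m n hmn).trans_le (by omega)).mono h (by omega) fun _ _ => le_rfl

/-- The inverse of a polynomial change of variables which is a perturbation of the identity by terms
of degree at least `N + 1`. -/
theorem IsSmall.perturb (h : IsSmall τ y) {Q : ℕ → ℕ → ℝ → ℂ}
    (hQ : ∀ m n, N + 1 ≤ m + n → m + n ≤ 2 * N + 1 →
      Continuous (Q m n) ∧ ∃ M, ∀ s, ‖Q m n s‖ ≤ M)
    (hQre : ∀ m n, m ≤ N → n ≤ N → ∀ s, (Q m n s).im = 0)
    (hw : ∀ t, w t = y t + ∑ p ∈ pairSet (N + 1) (2 * N + 1),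
      Q p.1 p.2 (lam t) * y t ^ p.1 * conj (y t) ^ p.2) :
    IsSmall τ w ∧ HasExpansion lam τ w (2 * N + 1) (monomialClass N 1 0) y := by
  have hmem : (1 : ℂ) ∈ monomialClass N 1 0 1 0 := by simp [mem_coeffClass, OffMonomial]
  have hexp : ∀ {v : ℝ → ℂ} {k : ℕ}, IsSmall τ v →
      HasExpansion lam τ v (k + 1) (monomialClass N 1 0) y →
      HasExpansion lam τ v (k + (N + 1))
        (coeffClass (fun m n => m + n < N + 1) (InBox N) Complex.imLm)
        (fun t => w t - y t) := fun hv hy => by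
    simp only [hw, add_sub_cancel_left]
    exact hy.sum_pairSet hv hQ (fun m n hmn hlt => by omega) hQre (fun m n hmn => by omega) le_rfl
  obtain ⟨B, hB, hwy⟩ := (hexp h (k := 0) (hasExpansion_self hmem)).exists_norm_le h
    (a := N + 1) (fun m n hmn => coeffClass_le_bot hmn) (by omega)
  have hsmall : IsSmall τ w := by
    obtain ⟨B', hB', hy⟩ := h.bound
    refine ⟨h.nonneg, h.le_one, B + B', by positivity, fun t ht => ?_⟩
    rw [add_mul]
    refine (norm_le_norm_sub_add _ (y t)).trans (add_le_add ((hwy t ht).trans ?_) (hy t ht))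
    gcongr
    exact pow_le_of_le_one (h.nonneg t ht) (h.le_one t ht) (by omega)
  refine ⟨hsmall, ?_⟩
  have hy : HasExpansion lam τ w (N + 1) (monomialClass N 1 0) y :=
    (hasExpansion_self hmem).congr ⟨B, hB, fun t ht => by rw [norm_sub_rev]; exact hwy t ht⟩
  have hQw := ((hexp hsmall hy).mono hsmall (L := 2 * N + 1) (by omega) fun m n =>
    coeffClass_mono (Z' := OffMonomial N 1 0) (R' := InBox N)
      (fun h => by have := h.2; omega) Or.inr).neg
  simpa using (hasExpansion_self (K := 2 * N + 1) hmem).add hQw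

/-- The product of the normal form with a derivative of a monomial of the change of variables. -/
theorem HasExpansion.coeff_mul_monomial_mul (h : IsSmall τ w)
    (hf : HasExpansion lam τ w K (monomialClass N a b) f)
    (hz : HasExpansion lam τ w J (coeffClass (NonResonant N) (InBox N) Complex.reLm) z)
    (hab : N ≤ a + b) {q : ℝ → ℂ} (hq : Continuous q) (hqM : ∃ M, ∀ s, ‖q s‖ ≤ M)
    (hqim : a + 1 ≤ N → b ≤ N → ∀ s, (q s).im = 0) (hK : J ≤ K + 2) (hJ : 2 ≤ J) :
    HasExpansion lam τ w J (coeffClass (fun m n => m + n < N + 1) (InBox N) Complex.reLm)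
      (fun t => q (lam t) * f t * z t) := by
  have hqf : HasExpansion lam τ w K
      (coeffClass (OffMonomial N a b) (fun m n => m + 1 ≤ N ∧ n ≤ N) Complex.imLm)
      (fun t => q (lam t) * f t) := by
    refine hf.const_mul h hq hqM fun m n s x hx => ?_
    simp only [mem_coeffClass, OffMonomial, InBox] at hx ⊢
    refine ⟨fun h => by rw [hx.1 h, mul_zero], fun h => ?_⟩
    by_cases hmn : m = a ∧ n = b
    · exact map_mul_eq_zero_of_im_eq_zero _ (hqim (by omega) (by omega) s) (hx.2 (by omega))
    · rw [hx.1 (by omega), mul_zero, map_zero]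
  refine hqf.mul h hz (a := 0) (b := 2) (fun m n hmn => by omega)
    (fun m n hmn => coeffClass_le_bot (Or.inl hmn)) hJ hK (by omega) fun m n m' n' x hx z hz => ?_
  simp only [mem_coeffClass, OffMonomial, InBox, NonResonant, Complex.imLm_coe,
    Complex.reLm_coe] at hx hz ⊢
  refine ⟨fun h => ?_, fun h => ?_⟩
  · rw [mul_eq_zero]
    by_contra! hne
    have h₁ := mt hx.1 hne.1
    have h₂ := mt hz.1 hne.2
    omega
  · by_cases hz0 : z = 0
    · simp [hz0]
    · have h₂ := mt hz.1 hz0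
      rw [Complex.mul_re, hx.2 (by omega), hz.2 (by omega)]
      simp

theorem HasExpansion.conj_imaginary {d : ℕ}
    (hf : HasExpansion lam τ w K (coeffClass (fun m n => m + n < d) (InBox N) Complex.reLm) f) :
    HasExpansion lam τ w K (coeffClass (fun m n => m + n < d) (InBox N) Complex.reLm)
      (fun t => conj (f t)) := by
  refine hf.conj fun m n x hx => ?_
  simp only [mem_coeffClass, InBox, Complex.reLm_coe] at hx ⊢
  exact ⟨fun h => by rw [hx.1 (by omega), map_zero],
    fun h => by rw [Complex.conj_re, hx.2 h.symm]⟩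

theorem hasDerivAt_coeff_mul_monomial {q : ℝ → ℂ} {t : ℝ} (hq : DifferentiableAt ℝ q (lam t))
    (hlam : DifferentiableAt ℝ lam t) (hy : DifferentiableAt ℝ y t) (a b : ℕ) :
    HasDerivAt (fun t => q (lam t) * y t ^ a * conj (y t) ^ b)
      (deriv q (lam t) * (y t ^ a * conj (y t) ^ b) * ((deriv lam t : ℝ) : ℂ) +
        q (lam t) * (a * (y t ^ (a - 1) * conj (y t) ^ b) * deriv y t +
          b * (y t ^ a * conj (y t) ^ (b - 1)) * conj (deriv y t))) t := by
  have h₁ := hq.hasDerivAt.scomp t hlam.hasDerivAt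
  have h₂ : HasDerivAt (fun t => conj (y t)) (conj (deriv y t)) t := hy.hasDerivAt.star
  refine ((h₁.mul (hy.hasDerivAt.pow a)).mul (h₂.pow b)).congr_deriv ?_
  simp only [Complex.real_smul, Function.comp_apply, Pi.mul_apply, Pi.pow_apply]
  ring

theorem im_deriv_eq_zero {q : ℝ → ℂ} (hq : Differentiable ℝ q) (hqim : ∀ s, (q s).im = 0) (s : ℝ) :
    (deriv q s).im = 0 := by
  have h := Complex.imCLM.hasFDerivAt.comp_hasDerivAt s (hq s).hasDerivAt
  have h0 : Complex.imCLM ∘ q = fun _ => 0 := funext hqim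
  rw [h0] at h
  exact h.unique (hasDerivAt_const s 0)

/-- The contribution of a single monomial of the change of variables to the new equation. -/
theorem HasExpansion.deriv_monomial_sub (h : IsSmall τ w) {ε : ℝ → ℝ} (hε : Continuous ε)
    (hεM : ∃ M, ∀ s, |ε s| ≤ M) {q : ℝ → ℂ} (hq : ContDiff ℝ 1 q)
    (hqM : ∃ M, ∀ s, ‖q s‖ ≤ M ∧ ‖deriv q s‖ ≤ M) (hqim : a ≤ N → b ≤ N → ∀ s, (q s).im = 0)
    (hlam : Differentiable ℝ lam) (hyd : Differentiable ℝ y) (hN : 1 ≤ N)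
    (hab : N + 1 ≤ a + b) (hy : HasExpansion lam τ w (2 * N + 1) (monomialClass N 1 0) y)
    (hz : HasExpansion lam τ w (2 * N + 2) (coeffClass (NonResonant N) (InBox N) Complex.reLm)
      (fun t => deriv y t - Complex.I * ε (lam t) * y t))
    (hl : HasExpansion lam τ w (2 * N + 2)
      (coeffClass (fun m n => m + n < 2) (InBox N) Complex.reLm) (fun t => ((deriv lam t : ℝ) : ℂ))) :
    HasExpansion lam τ w (2 * N + 2)
      (coeffClass (fun m n => m + n < N + 1) (InBox N) Complex.reLm)
      (fun t => deriv (fun t => q (lam t) * y t ^ a * conj (y t) ^ b) t -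
        Complex.I * ε (lam t) * (q (lam t) * y t ^ a * conj (y t) ^ b)) := by
  have hqd : Differentiable ℝ q := hq.differentiable one_ne_zero
  obtain ⟨M, hM⟩ := hqM
  have hM0 : 0 ≤ M := (norm_nonneg _).trans (hM 0).1
  have hlamTerm : HasExpansion lam τ w (2 * N + 2)
      (coeffClass (fun m n => m + n < N + 1) (InBox N) Complex.reLm)
      (fun t => deriv q (lam t) * (y t ^ a * conj (y t) ^ b) * ((deriv lam t : ℝ) : ℂ)) := by
    have hmon : HasExpansion lam τ w (2 * N + (a + b))
        (coeffClass (fun m n => m + n < N + 1) (InBox N) Complex.imLm)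
        (fun t => deriv q (lam t) * (y t ^ a * conj (y t) ^ b)) :=
      (hy.monomial h a b).coeff_mul_monomial h (hq.continuous_deriv le_rfl)
        ⟨M, fun s => (hM s).2⟩ (fun hlt => by omega)
        (fun ha hb => im_deriv_eq_zero hqd (hqim ha hb)) fun m n hmn => by omega
    refine hmon.mul h hl (a := 0) (b := 2) (fun m n hmn => by omega)
      (fun m n hmn => coeffClass_le_bot hmn) (by omega) (by omega) (by omega)
      fun m n m' n' x hx z hz => ?_
    simp only [mem_coeffClass, InBox, Complex.imLm_coe, Complex.reLm_coe] at hx hz ⊢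
    refine ⟨fun h => ?_, fun h => ?_⟩
    · rw [hx.1 (by omega), zero_mul]
    · rw [Complex.mul_re, hx.2 (by omega), hz.2 (by omega)]
      simp
  have hyTerm : HasExpansion lam τ w (2 * N + 2)
      (coeffClass (fun m n => m + n < N + 1) (InBox N) Complex.reLm)
      (fun t => a * q (lam t) * (y t ^ (a - 1) * conj (y t) ^ b) *
        (deriv y t - Complex.I * ε (lam t) * y t)) := by
    rcases Nat.eq_zero_or_pos a with rfl | ha
    · simpa using hasExpansion_zero
    · refine (hy.monomial h (a - 1) b).coeff_mul_monomial_mul h hz (by omega)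
        (q := fun s => a * q s) (continuous_const.mul hq.continuous)
        ⟨a * M, fun s => ?_⟩ (fun ha' hb s => ?_) (by omega) (by omega)
      · rw [norm_mul, Complex.norm_natCast]
        gcongr
        exact (hM s).1
      · simp [hqim (by omega) hb s]
  have hconjTerm : HasExpansion lam τ w (2 * N + 2)
      (coeffClass (fun m n => m + n < N + 1) (InBox N) Complex.reLm)
      (fun t => b * q (lam t) * (y t ^ a * conj (y t) ^ (b - 1)) *
        conj (deriv y t - Complex.I * ε (lam t) * y t)) := by
    rcases Nat.eq_zero_or_pos b with rfl | hb
    · simpa using hasExpansion_zero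
    · have hterm := ((hy.monomial h (b - 1) a).coeff_mul_monomial_mul h hz (by omega)
        (q := fun s => b * conj (q s))
        (continuous_const.mul (Complex.continuous_conj.comp hq.continuous))
        ⟨b * M, fun s => by
          rw [norm_mul, Complex.norm_natCast, Complex.norm_conj]
          gcongr
          exact (hM s).1⟩
        (fun hb' ha s => by simp [hqim ha (by omega) s]) (by omega) (by omega)).conj_imaginary
      convert hterm using 2 with t
      simp only [map_mul, map_pow, Complex.conj_conj, Complex.conj_natCast]
      ring
  have hεTerm : HasExpansion lam τ w (2 * N + 2)
      (coeffClass (fun m n => m + n < N + 1) (InBox N) Complex.reLm)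
      (fun t => (Complex.I * ε (lam t) * (a - b - 1)) * q (lam t) *
        (y t ^ a * conj (y t) ^ b)) := by
    obtain ⟨E, hE⟩ := hεM
    have hE0 : 0 ≤ E := (abs_nonneg _).trans (hE 0)
    refine ((hy.monomial h a b).coeff_mul_monomial h
      (q := fun s => (Complex.I * ε s * (a - b - 1)) * q s) (by fun_prop)
      ⟨E * ‖(a - b - 1 : ℂ)‖ * M, fun s => ?_⟩ (fun hlt => by omega) (fun ha hb s => ?_)
      (fun m n hmn => by omega)).mono h (by omega) fun _ _ => le_rfl
    · simp only [norm_mul, Complex.norm_I, one_mul, Complex.norm_real, Real.norm_eq_abs]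
      gcongr
      · exact hE s
      · exact (hM s).1
    · simp [hqim ha hb s]
  convert ((hlamTerm.add hyTerm).add hconjTerm).add hεTerm using 2 with t
  rw [(hasDerivAt_coeff_mul_monomial (hqd _) (hlam t) (hyd t) a b).deriv]
  have hpow : ∀ (n : ℕ) (x : ℂ), n * x ^ (n - 1) * x = n * x ^ n := by
    rintro (_ | n) x
    · simp
    · rw [mul_assoc, Nat.add_sub_cancel, pow_succ]
  simp only [map_sub, map_mul, Complex.conj_I, Complex.conj_ofReal]
  linear_combination Complex.I * ε (lam t) * q (lam t) *
    (conj (y t) ^ b * hpow a (y t) - y t ^ a * hpow b (conj (y t)))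

end NormalForm

/-- Invariance of the normal form under polynomial changes of variables: if `y, λ`
satisfy the normal-form equations with coefficients `Θ_{m,n}, Λ_{m,n}` (purely
imaginary for `m,n ≤ N`, with `Θ_{m,n} = 0` when `m+n ≤ N` and `m ≠ n+1`) up to
remainders `O((T₀+t)^{-(2N+2)/(2N)})`, and `β = y + Σ_{N+1≤m+n≤2N+1} p_{m,n}(λ) yᵐ ȳⁿ`
with `p_{m,n}` real for `m,n ≤ N`, then `β, λ` satisfy equations of the same form:
the new coefficients `Θ⁽¹⁾_{m,n}, Λ⁽¹⁾_{m,n}` are purely imaginary for `m,n ≤ N`,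
vanish when `m+n ≤ N` and `m ≠ n+1` (for `Θ⁽¹⁾`), and the remainders keep the bound
`C(T₀+t)^{-(2N+2)/(2N)}`. -/
theorem normal_form_invariance (N : ℕ) (hN : 1 ≤ N) (T₀ C₀ : ℝ)
    (hT₀ : 1 ≤ T₀) (hC₀ : 0 < C₀)
    (ε : ℝ → ℝ) (hε : ContDiff ℝ 1 ε)
    (hεbd : ∃ M : ℝ, ∀ s : ℝ, |ε s| ≤ M ∧ |deriv ε s| ≤ M)
    (Θ Λ : ℕ → ℕ → ℝ → ℂ)
    (hΘreg : ∀ m n : ℕ, 2 ≤ m + n → m + n ≤ 2 * N + 1 →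
      ContDiff ℝ 1 (Θ m n) ∧ ∃ M : ℝ, ∀ s : ℝ, ‖Θ m n s‖ ≤ M ∧ ‖deriv (Θ m n) s‖ ≤ M)
    (hΛreg : ∀ m n : ℕ, 2 ≤ m + n → m + n ≤ 2 * N + 1 →
      ContDiff ℝ 1 (Λ m n) ∧ ∃ M : ℝ, ∀ s : ℝ, ‖Λ m n s‖ ≤ M ∧ ‖deriv (Λ m n) s‖ ≤ M)
    (hΘim : ∀ m n : ℕ, m ≤ N → n ≤ N → ∀ s : ℝ, (Θ m n s).re = 0)
    (hΛim : ∀ m n : ℕ, m ≤ N → n ≤ N → ∀ s : ℝ, (Λ m n s).re = 0)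
    (hΘ0 : ∀ m n : ℕ, m + n ≤ N → m ≠ n + 1 → ∀ s : ℝ, Θ m n s = 0)
    (P : ℕ → ℕ → ℝ → ℂ)
    (hPreg : ∀ m n : ℕ, N + 1 ≤ m + n → m + n ≤ 2 * N + 1 →
      ContDiff ℝ 1 (P m n) ∧ ∃ M : ℝ, ∀ s : ℝ, ‖P m n s‖ ≤ M ∧ ‖deriv (P m n) s‖ ≤ M)
    (hPre : ∀ m n : ℕ, m ≤ N → n ≤ N → ∀ s : ℝ, (P m n s).im = 0)
    (y : ℝ → ℂ) (lam : ℝ → ℝ) (hy : ContDiff ℝ 1 y) (hlam : ContDiff ℝ 1 lam)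
    (hybd : ∀ t : ℝ, 0 ≤ t → ‖y t‖ ≤ C₀ * (T₀ + t) ^ (-(1 / (2 * (N : ℝ)))))
    (hyeq : ∀ t : ℝ, 0 ≤ t →
      ‖deriv y t - Complex.I * (ε (lam t) : ℂ) * y t -
          ∑ p ∈ pairSet 2 (2 * N + 1),
            Θ p.1 p.2 (lam t) * y t ^ p.1 * (starRingEnd ℂ) (y t) ^ p.2‖ ≤
        C₀ * (T₀ + t) ^ (-((2 * (N : ℝ) + 2) / (2 * (N : ℝ)))))
    (hlameq : ∀ t : ℝ, 0 ≤ t →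
      ‖((deriv lam t : ℝ) : ℂ) -
          ∑ p ∈ pairSet 2 (2 * N + 1),
            Λ p.1 p.2 (lam t) * y t ^ p.1 * (starRingEnd ℂ) (y t) ^ p.2‖ ≤
        C₀ * (T₀ + t) ^ (-((2 * (N : ℝ) + 2) / (2 * (N : ℝ))))) :
    ∃ (Θ₁ Λ₁ : ℕ → ℕ → ℝ → ℂ) (C : ℝ),
      0 < C ∧
      (∀ m n : ℕ, 2 ≤ m + n → m + n ≤ 2 * N + 1 →
        (∃ M : ℝ, ∀ s : ℝ, ‖Θ₁ m n s‖ ≤ M) ∧ ∃ M : ℝ, ∀ s : ℝ, ‖Λ₁ m n s‖ ≤ M) ∧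
      (∀ m n : ℕ, m ≤ N → n ≤ N → ∀ s : ℝ, (Θ₁ m n s).re = 0 ∧ (Λ₁ m n s).re = 0) ∧
      (∀ m n : ℕ, m + n ≤ N → m ≠ n + 1 → ∀ s : ℝ, Θ₁ m n s = 0) ∧
      ∀ β : ℝ → ℂ,
        (∀ t : ℝ, β t = y t + ∑ p ∈ pairSet (N + 1) (2 * N + 1),
            P p.1 p.2 (lam t) * y t ^ p.1 * (starRingEnd ℂ) (y t) ^ p.2) →
        (∀ t : ℝ, 0 ≤ t →
          ‖deriv β t - Complex.I * (ε (lam t) : ℂ) * β t -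
              ∑ p ∈ pairSet 2 (2 * N + 1),
                Θ₁ p.1 p.2 (lam t) * β t ^ p.1 * (starRingEnd ℂ) (β t) ^ p.2‖ ≤
            C * (T₀ + t) ^ (-((2 * (N : ℝ) + 2) / (2 * (N : ℝ))))) ∧
        (∀ t : ℝ, 0 ≤ t →
          ‖((deriv lam t : ℝ) : ℂ) -
              ∑ p ∈ pairSet 2 (2 * N + 1),
                Λ₁ p.1 p.2 (lam t) * β t ^ p.1 * (starRingEnd ℂ) (β t) ^ p.2‖ ≤
            C * (T₀ + t) ^ (-((2 * (N : ℝ) + 2) / (2 * (N : ℝ))))) := by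
  obtain ⟨E, hE⟩ := hεbd
  set τ : ℝ → ℝ := fun t => (T₀ + t) ^ (-(1 / (2 * (N : ℝ)))) with hτ
  have hN0 : (N : ℝ) ≠ 0 := by positivity
  have hτpow : ∀ t, 0 ≤ t →
      (T₀ + t) ^ (-((2 * (N : ℝ) + 2) / (2 * (N : ℝ)))) = τ t ^ (2 * N + 2) := fun t ht => by
    rw [hτ, ← Real.rpow_natCast, ← Real.rpow_mul (by positivity)]
    congr 1
    push_cast
    field_simp
  have hsmall : IsSmall τ y :=
    ⟨fun t ht => by positivity,
      fun t ht => Real.rpow_le_one_of_one_le_of_nonpos (by linarith) (by simp), C₀, hC₀.le, hybd⟩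
  let β : ℝ → ℂ := fun t => y t + ∑ p ∈ pairSet (N + 1) (2 * N + 1),
    P p.1 p.2 (lam t) * y t ^ p.1 * (starRingEnd ℂ) (y t) ^ p.2
  have hyd : Differentiable ℝ y := hy.differentiable one_ne_zero
  have hlamd : Differentiable ℝ lam := hlam.differentiable one_ne_zero
  obtain ⟨hβ, hyβ⟩ := hsmall.perturb (w := β) (lam := lam)
    (fun m n h₁ h₂ => ⟨(hPreg m n h₁ h₂).1.continuous,
      (hPreg m n h₁ h₂).2.imp fun _ h s => (h s).1⟩) hPre fun _ => rfl
  have hz : HasExpansion lam τ β (2 * N + 2) (coeffClass (NonResonant N) (InBox N) Complex.reLm)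
      (fun t => deriv y t - Complex.I * ε (lam t) * y t) := by
    refine (hyβ.sum_pairSet hβ (lo := 2) (hi := 2 * N + 1) (Q := Θ)
      (fun m n h₁ h₂ => ⟨(hΘreg m n h₁ h₂).1.continuous,
        (hΘreg m n h₁ h₂).2.imp fun _ h s => (h s).1⟩)
      (fun m n hmn hres => hΘ0 m n (by unfold NonResonant at hres; omega)
        (by unfold NonResonant at hres; omega)) hΘim
      (fun m n hres => by unfold NonResonant at hres; omega) le_rfl).congr
      ⟨C₀, hC₀.le, fun t ht => ?_⟩
    rw [← hτpow t ht]
    exact hyeq t ht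
  have hl : HasExpansion lam τ β (2 * N + 2)
      (coeffClass (fun m n => m + n < 2) (InBox N) Complex.reLm)
      (fun t => ((deriv lam t : ℝ) : ℂ)) := by
    refine (hyβ.sum_pairSet hβ (lo := 2) (hi := 2 * N + 1) (Q := Λ)
      (fun m n h₁ h₂ => ⟨(hΛreg m n h₁ h₂).1.continuous,
        (hΛreg m n h₁ h₂).2.imp fun _ h s => (h s).1⟩)
      (fun m n hmn hlt => by omega) hΛim (fun m n hlt => by omega) le_rfl).congr
      ⟨C₀, hC₀.le, fun t ht => ?_⟩
    rw [← hτpow t ht]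
    exact hlameq t ht
  have hdβ : HasExpansion lam τ β (2 * N + 2) (coeffClass (NonResonant N) (InBox N) Complex.reLm)
      (fun t => deriv β t - Complex.I * ε (lam t) * β t) := by
    have hterm := HasExpansion.sum (s := pairSet (N + 1) (2 * N + 1)) fun p hp =>
      have ⟨h₁, h₂⟩ := mem_pairSet.mp hp
      (HasExpansion.deriv_monomial_sub hβ hε.continuous ⟨E, fun s => (hE s).1⟩
        (hPreg p.1 p.2 h₁ h₂).1 (hPreg p.1 p.2 h₁ h₂).2 (hPre p.1 p.2) hlamd hyd hN h₁ hyβ hz hl)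
    convert hz.add (hterm.mono hβ le_rfl fun m n => coeffClass_mono
      (Z' := NonResonant N) (R' := InBox N) (fun h => by unfold NonResonant at h; omega) Or.inr)
      using 2 with t
    have hdiff : ∀ p ∈ pairSet (N + 1) (2 * N + 1), DifferentiableAt ℝ
        (fun t => P p.1 p.2 (lam t) * y t ^ p.1 * (starRingEnd ℂ) (y t) ^ p.2) t := fun p hp =>
      have ⟨h₁, h₂⟩ := mem_pairSet.mp hp
      (hasDerivAt_coeff_mul_monomial ((hPreg p.1 p.2 h₁ h₂).1.differentiable one_ne_zero _)
        (hlamd t) (hyd t) p.1 p.2).differentiableAt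
    have hderiv : deriv β t = deriv y t + ∑ p ∈ pairSet (N + 1) (2 * N + 1),
        deriv (fun t => P p.1 p.2 (lam t) * y t ^ p.1 * (starRingEnd ℂ) (y t) ^ p.2) t :=
      ((hyd t).hasDerivAt.add
        (HasDerivAt.fun_sum fun p hp => (hdiff p hp).hasDerivAt)).deriv
    rw [hderiv, Finset.sum_sub_distrib, ← Finset.mul_sum]
    ring
  obtain ⟨Θ₁, B, hB, hΘ₁M, hΘ₁, hΘ₁eq⟩ := hdβ.exists_sum_pairSet hβ (a := 2) (K := 2 * N + 1)
    fun m n hmn => coeffClass_le_bot (Or.inl hmn)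
  obtain ⟨Λ₁, B', hB', hΛ₁M, hΛ₁, hΛ₁eq⟩ := hl.exists_sum_pairSet hβ (a := 2) (K := 2 * N + 1)
    fun m n hmn => coeffClass_le_bot hmn
  refine ⟨Θ₁, Λ₁, B + B' + 1, by positivity, fun m n _ _ => ⟨hΘ₁M m n, hΛ₁M m n⟩,
    fun m n hm hn s => ⟨(hΘ₁ m n s).2 ⟨hm, hn⟩, (hΛ₁ m n s).2 ⟨hm, hn⟩⟩,
    fun m n hmn hne s => (hΘ₁ m n s).1 (Or.inr ⟨hmn, hne⟩), fun γ hγ => ?_⟩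
  obtain rfl : γ = β := funext hγ
  refine ⟨fun t ht => ?_, fun t ht => ?_⟩
  · rw [hτpow t ht]
    have hτ0 := hsmall.nonneg t ht
    refine (hΘ₁eq t ht).trans ?_
    gcongr
    linarith
  · rw [hτpow t ht]
    have hτ0 := hsmall.nonneg t ht
    refine (hΛ₁eq t ht).trans ?_
    gcongr
    linarith
end
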